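/- Let R be a commutative Noetherian local ring and M a finitely generated R-module with finite reducing Gorenstein dimension. If S is the kernel of a surjective R-linear map F → M with F finitely generated free (i.e., S is a first syzygy of M), then S has finite reducing Gorenstein dimension. -/

import Mathlib

open CategoryTheory

universe u

variable (R : Type u) [CommRing R]

/-- `SES R A B C` : there is a short exact sequence `0 → A → B → C → 0` of `R`-modules. -/
def SES (A B C : ModuleCat.{u} R) : Prop :=
  ∃ (f : A →ₗ[R] B) (g : B →ₗ[R] C),
    Function.Injective f ∧ Function.Surjective g ∧ LinearMap.range f = LinearMap.ker g

/-- A finitely generated free module. -/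
def IsFinFree (F : ModuleCat.{u} R) : Prop :=
  Module.Finite R F ∧ Module.Free R F

/-- `IsSyzygy R n S K` : `S` is an `n`-th syzygy of `K`, i.e. there is an exact sequence
`0 → S → F_{n-1} → ⋯ → F_0 → K → 0` with each `F_j` finitely generated free
(for `n = 0` this just means `S ≅ K`). -/
def IsSyzygy : ℕ → ModuleCat.{u} R → ModuleCat.{u} R → Prop
  | 0, S, K => Nonempty (S ≃ₗ[R] K)
  | n + 1, S, K => ∃ T F : ModuleCat.{u} R, IsSyzygy n T K ∧ IsFinFree R F ∧ SES R S F T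

/-- The direct sum `M^{⊕ a}`. -/
def MPow (M : ModuleCat.{u} R) (a : ℕ) : ModuleCat.{u} R := ModuleCat.of R (Fin a → M)

/-- `IsReducingSeq R K` : the finitely generated modules `K 0, …, K r` form a reducing
sequence, i.e. there are positive integers `a i, b i, n i` and short exact sequences
`0 → (K i)^{⊕ a i} → K (i+1) → S i → 0` where `S i` is an `(n i)`-th syzygy
of `(K i)^{⊕ b i}`. -/
def IsReducingSeq {r : ℕ} (K : Fin (r + 1) → ModuleCat.{u} R) : Prop :=
  (∀ i, Module.Finite R (K i)) ∧
  ∃ a b n : Fin r → ℕ,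
    (∀ i, 0 < a i) ∧ (∀ i, 0 < b i) ∧ (∀ i, 0 < n i) ∧
    ∀ i : Fin r, ∃ S : ModuleCat.{u} R,
      IsSyzygy R (n i) S (MPow R (K i.castSucc) (b i)) ∧
      SES R (MPow R (K i.castSucc) (a i)) (K i.succ) S

/-- `ExtVanishes R M N i` : the `R`-module `Ext^i_R(M, N)` is zero. -/
def ExtVanishes (M N : ModuleCat.{u} R) (i : ℕ) : Prop :=
  Subsingleton (((Ext R (ModuleCat.{u} R) i).obj (Opposite.op M)).obj N)

/-- A totally reflexive module. -/
def IsTotallyReflexive (M : ModuleCat.{u} R) : Prop :=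
  Function.Bijective (Module.Dual.eval R M) ∧
  ∀ i : ℕ, 1 ≤ i →
    ExtVanishes R M (ModuleCat.of R R) i ∧
    ExtVanishes R (ModuleCat.of R (Module.Dual R M)) (ModuleCat.of R R) i

/-- `ResolvedBy R P m M` : there is an exact sequence `0 → G_m → ⋯ → G_0 → M → 0`
in which each `G_j` satisfies `P`. -/
def ResolvedBy (P : ModuleCat.{u} R → Prop) : ℕ → ModuleCat.{u} R → Prop
  | 0, M => ∃ G : ModuleCat.{u} R, P G ∧ Nonempty (G ≃ₗ[R] M)
  | m + 1, M => ∃ G S : ModuleCat.{u} R, P G ∧ SES R S G M ∧ ResolvedBy P m S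

/-- Finite Gorenstein dimension. -/
def FiniteGdim (M : ModuleCat.{u} R) : Prop :=
  ∃ m : ℕ, ResolvedBy R (IsTotallyReflexive R) m M

/-- Finite projective dimension. -/
def FinitePd (M : ModuleCat.{u} R) : Prop :=
  ∃ m : ℕ, ResolvedBy R (fun G => Module.Projective R G) m M

/-- `HasRedSeqTo R P M` : `M` admits a reducing sequence `K_0 = M, K_1, …, K_r`
whose last module `K_r` satisfies `P`. -/
def HasRedSeqTo (P : ModuleCat.{u} R → Prop) (M : ModuleCat.{u} R) : Prop :=
  ∃ (r : ℕ) (K : Fin (r + 1) → ModuleCat.{u} R),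
    K 0 = M ∧ IsReducingSeq R K ∧ P (K (Fin.last r))

/-- Finite reducing Gorenstein dimension. -/
def FiniteRedGdim (M : ModuleCat.{u} R) : Prop :=
  HasRedSeqTo R (FiniteGdim R) M

/-- Finite reducing projective dimension. -/
def FiniteRedPd (M : ModuleCat.{u} R) : Prop :=
  HasRedSeqTo R (FinitePd R) M


section ExtPart

variable {R}

lemma extVanishes_iff (M N : ModuleCat.{u} R) (n : ℕ) :
    ExtVanishes R M N (n + 1) ↔ Subsingleton (Abelian.Ext.{u} M N (n + 1)) := by
  let P := projectiveResolution M
  have h1 : Subsingleton (Abelian.Ext.{u} M N (n + 1)) ↔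
      ∀ f : P.complex.X (n + 1) ⟶ N, P.complex.d (n + 2) (n + 1) ≫ f = 0 →
        ∃ g : P.complex.X n ⟶ N, P.complex.d (n + 1) n ≫ g = f := by
    constructor
    · intro h f hf
      exact (P.extMk_eq_zero_iff f (n + 2) rfl hf n rfl).1 (Subsingleton.elim _ _)
    · intro h
      refine ⟨fun x y => ?_⟩
      have key : ∀ x : Abelian.Ext.{u} M N (n + 1), x = 0 := by
        intro x
        obtain ⟨f, hf, rfl⟩ := P.extMk_surjective x (n + 2) rfl
        exact (P.extMk_eq_zero_iff f (n + 2) rfl hf n rfl).2 (h f hf)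
      rw [key x, key y]
  rw [h1]
  have h2 : ExtVanishes R M N (n + 1) ↔
      (P.complex.linearYonedaObj R N).ExactAt (n + 1) := by
    rw [HomologicalComplex.exactAt_iff_isZero_homology, ← (P.isoExt (R := R) (n + 1) N).isZero_iff,
      ModuleCat.isZero_iff_subsingleton]
    rfl
  rw [h2, HomologicalComplex.exactAt_iff' _ n (n + 1) (n + 2) (by simp) (by simp),
    ShortComplex.moduleCat_exact_iff]
  rfl

lemma ses_shortExact {A B C : ModuleCat.{u} R} {f : A →ₗ[R] B} {g : B →ₗ[R] C}
    (hf : Function.Injective f) (hg : Function.Surjective g)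
    (hfg : LinearMap.range f = LinearMap.ker g)
    : ∃ S : ShortComplex (ModuleCat.{u} R), S.ShortExact ∧
    ∃ (e1 : S.X₁ = A) (e2 : S.X₂ = B) (e3 : S.X₃ = C),
      S.f = eqToHom e1 ≫ ModuleCat.ofHom f ≫ eqToHom e2.symm ∧
      S.g = eqToHom e2 ≫ ModuleCat.ofHom g ≫ eqToHom e3.symm := by
  have w : ModuleCat.ofHom f ≫ ModuleCat.ofHom g = 0 := by
    ext x
    have : f x ∈ LinearMap.ker g := hfg ▸ LinearMap.mem_range_self f x
    simpa using this
  refine ⟨ShortComplex.mk (ModuleCat.ofHom f) (ModuleCat.ofHom g) w, ?_, rfl, rfl, rfl,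
    by simp, by simp⟩
  have hm := (ModuleCat.mono_iff_injective (ModuleCat.ofHom f)).2 hf
  have he := (ModuleCat.epi_iff_surjective (ModuleCat.ofHom g)).2 hg
  refine { exact := ?_, mono_f := hm, epi_g := he }
  rw [ShortComplex.moduleCat_exact_iff]
  intro x hx
  have : x ∈ LinearMap.range f := hfg ▸ hx
  exact this

lemma ext_ker {A B C : ModuleCat.{u} R} {f : A →ₗ[R] B} {g : B →ₗ[R] C}
    (hf : Function.Injective f) (hg : Function.Surjective g)
    (hfg : LinearMap.range f = LinearMap.ker g)
    (N : ModuleCat.{u} R) (i : ℕ) (hB : ExtVanishes R B N (i + 1))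
    (hC : ExtVanishes R C N (i + 2)) : ExtVanishes R A N (i + 1) := by
  rw [extVanishes_iff] at *
  obtain ⟨S, hS, rfl, rfl, rfl, -, -⟩ := ses_shortExact hf hg hfg
  have key : ∀ x : Abelian.Ext.{u} S.X₁ N (i + 1), x = 0 := fun x => by
    obtain ⟨y, rfl⟩ := Abelian.Ext.contravariant_sequence_exact₁ hS N x (n₁ := i + 2) (by omega)
      (Subsingleton.elim _ _)
    rw [Subsingleton.elim y 0]; simp
  exact ⟨fun x y => by rw [key x, key y]⟩

lemma ext_mid {A B C : ModuleCat.{u} R} {f : A →ₗ[R] B} {g : B →ₗ[R] C}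
    (hf : Function.Injective f) (hg : Function.Surjective g)
    (hfg : LinearMap.range f = LinearMap.ker g)
    (N : ModuleCat.{u} R) (i : ℕ) (hA : ExtVanishes R A N (i + 1))
    (hC : ExtVanishes R C N (i + 1)) : ExtVanishes R B N (i + 1) := by
  rw [extVanishes_iff] at *
  obtain ⟨S, hS, rfl, rfl, rfl, -, -⟩ := ses_shortExact hf hg hfg
  have key : ∀ x : Abelian.Ext.{u} S.X₂ N (i + 1), x = 0 := fun x => by
    obtain ⟨y, rfl⟩ := Abelian.Ext.contravariant_sequence_exact₂ hS N x
      (Subsingleton.elim _ _)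
    rw [Subsingleton.elim y 0]; simp
  exact ⟨fun x y => by rw [key x, key y]⟩

lemma ext_coker {A B C : ModuleCat.{u} R} {f : A →ₗ[R] B} {g : B →ₗ[R] C}
    (hf : Function.Injective f) (hg : Function.Surjective g)
    (hfg : LinearMap.range f = LinearMap.ker g)
    (N : ModuleCat.{u} R) (i : ℕ) (hA : ExtVanishes R A N (i + 1))
    (hB : ExtVanishes R B N (i + 2)) : ExtVanishes R C N (i + 2) := by
  rw [extVanishes_iff] at *
  obtain ⟨S, hS, rfl, rfl, rfl, -, -⟩ := ses_shortExact hf hg hfg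
  have key : ∀ x : Abelian.Ext.{u} S.X₃ N (i + 2), x = 0 := fun x => by
    obtain ⟨y, rfl⟩ := Abelian.Ext.contravariant_sequence_exact₃ hS N x
      (Subsingleton.elim _ _) (n₀ := i + 1) (by omega)
    rw [Subsingleton.elim y 0]; simp
  exact ⟨fun x y => by rw [key x, key y]⟩

lemma ext_one_extend {A B C : ModuleCat.{u} R} {f : A →ₗ[R] B} {g : B →ₗ[R] C}
    (hf : Function.Injective f) (hg : Function.Surjective g)
    (hfg : LinearMap.range f = LinearMap.ker g)
    (N : ModuleCat.{u} R) (hC : ExtVanishes R C N 1) (φ : A →ₗ[R] N) :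
    ∃ ψ : B →ₗ[R] N, ψ ∘ₗ f = φ := by
  rw [extVanishes_iff] at *
  obtain ⟨S, hS, rfl, rfl, rfl, h1, h2⟩ := ses_shortExact hf hg hfg
  obtain ⟨y, hy⟩ := Abelian.Ext.contravariant_sequence_exact₁ hS N
    (Abelian.Ext.mk₀ (ModuleCat.ofHom φ)) (n₁ := 1) (by omega)
      (Subsingleton.elim _ _)
  obtain ⟨ψ, rfl⟩ := Abelian.Ext.addEquiv₀.symm.surjective y
  rw [Abelian.Ext.addEquiv₀_symm_apply, Abelian.Ext.mk₀_comp_mk₀] at hy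
  have := (Abelian.Ext.mk₀_bijective _ _).1 hy
  refine ⟨ψ.hom, ?_⟩
  simp [h1] at this
  simpa using congrArg ModuleCat.Hom.hom this

lemma ext_one_of_extend {A B C : ModuleCat.{u} R} {f : A →ₗ[R] B} {g : B →ₗ[R] C}
    (hf : Function.Injective f) (hg : Function.Surjective g)
    (hfg : LinearMap.range f = LinearMap.ker g)
    (N : ModuleCat.{u} R) (hB : ExtVanishes R B N 1)
    (h : ∀ φ : A →ₗ[R] N, ∃ ψ : B →ₗ[R] N, ψ ∘ₗ f = φ) : ExtVanishes R C N 1 := by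
  rw [extVanishes_iff] at *
  obtain ⟨S, hS, rfl, rfl, rfl, h1, h2⟩ := ses_shortExact hf hg hfg
  have key : ∀ x : Abelian.Ext.{u} S.X₃ N 1, x = 0 := fun x => by
    obtain ⟨y, rfl⟩ := Abelian.Ext.contravariant_sequence_exact₃ hS N x
      (Subsingleton.elim _ _) (n₀ := 0) (by omega)
    obtain ⟨φ, rfl⟩ := Abelian.Ext.addEquiv₀.symm.surjective y
    obtain ⟨ψ, hψ⟩ := h φ.hom
    have : S.f ≫ ModuleCat.ofHom ψ = φ := by
      ext1
      rw [h1]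
      simpa using hψ
    rw [Abelian.Ext.addEquiv₀_symm_apply, ← this, ← Abelian.Ext.mk₀_comp_mk₀,
      hS.extClass_comp_assoc]
  exact ⟨fun x y => by rw [key x, key y]⟩

end ExtPart

section TRPart

variable {R}

lemma dual_exact {A B C : ModuleCat.{u} R} {f : A →ₗ[R] B} {g : B →ₗ[R] C}
    (hg : Function.Surjective g) (hfg : LinearMap.range f = LinearMap.ker g) :
    Function.Injective g.dualMap ∧ LinearMap.range g.dualMap = LinearMap.ker f.dualMap := by
  refine ⟨LinearMap.dualMap_injective_of_surjective hg, ?_⟩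
  ext β
  constructor
  · rintro ⟨χ, rfl⟩
    rw [LinearMap.mem_ker]
    ext a
    have : f a ∈ LinearMap.ker g := hfg ▸ LinearMap.mem_range_self f a
    rw [LinearMap.mem_ker] at this
    simp [LinearMap.dualMap_apply, this]
  · intro hβ
    have hk : LinearMap.ker g ≤ LinearMap.ker β := by
      rw [← hfg]
      rintro _ ⟨a, rfl⟩
      exact LinearMap.congr_fun hβ a
    have hχ : ∃ χ : C →ₗ[R] R, χ ∘ₗ g = β := by
      let e := g.quotKerEquivOfSurjective hg
      refine ⟨(LinearMap.ker g).liftQ β hk ∘ₗ e.symm.toLinearMap, ?_⟩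
      ext b
      have : e.symm (g b) = (LinearMap.ker g).mkQ b := by
        rw [LinearEquiv.symm_apply_eq]; rfl
      simp [this]
    exact hχ

lemma tr_ker {A B C : ModuleCat.{u} R} (h : SES R A B C) (hB : IsTotallyReflexive R B)
    (hC : IsTotallyReflexive R C) : IsTotallyReflexive R A := by
  obtain ⟨f, g, hf, hg, hfg⟩ := h
  have hext := ext_one_extend hf hg hfg (ModuleCat.of R R) (hC.2 1 le_rfl).1
  have hfs : Function.Surjective f.dualMap := hext
  obtain ⟨hgi, hd⟩ := dual_exact (f := f) hg hfg
  refine ⟨⟨?_, ?_⟩, ?_⟩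
  · rw [injective_iff_map_eq_zero]
    intro a ha
    apply hf
    apply hB.1.1
    ext β
    simpa using LinearMap.congr_fun ha (f.dualMap β)
  · intro ξ
    obtain ⟨b, hb⟩ := hB.1.2 (ξ ∘ₗ f.dualMap)
    have hgb : g b = 0 := by
      apply hC.1.1
      ext χ
      have h1 := LinearMap.congr_fun hb (g.dualMap χ)
      have h2 : f.dualMap (g.dualMap χ) = 0 := by
        rw [← LinearMap.mem_ker, ← hd]; exact LinearMap.mem_range_self _ _
      simp only [LinearMap.comp_apply, h2, map_zero] at h1
      simpa using h1
    have : b ∈ LinearMap.range f := by rw [hfg]; exact hgb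
    obtain ⟨a, rfl⟩ := this
    refine ⟨a, ?_⟩
    ext α
    obtain ⟨β, rfl⟩ := hfs α
    simpa using LinearMap.congr_fun hb β
  · intro i hi
    obtain ⟨i, rfl⟩ := Nat.exists_eq_add_of_le' hi
    refine ⟨ext_ker hf hg hfg _ i (hB.2 _ (by omega)).1 (hC.2 _ (by omega)).1, ?_⟩
    rcases i with _ | i
    · refine ext_one_of_extend (A := ModuleCat.of R (Module.Dual R C))
        (B := ModuleCat.of R (Module.Dual R B)) (f := g.dualMap) (g := f.dualMap)
        hgi hfs hd _ (hB.2 _ (by omega)).2 ?_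
      intro φ
      obtain ⟨c, rfl⟩ := hC.1.2 φ
      obtain ⟨b, rfl⟩ := hg c
      refine ⟨Module.Dual.eval R B b, ?_⟩
      ext χ
      rfl
    · exact ext_coker (A := ModuleCat.of R (Module.Dual R C))
        (B := ModuleCat.of R (Module.Dual R B)) (f := g.dualMap) (g := f.dualMap)
        hgi hfs hd _ i (hC.2 _ (by omega)).2 (hB.2 _ (by omega)).2

lemma tr_mid {A B C : ModuleCat.{u} R} (h : SES R A B C) (hA : IsTotallyReflexive R A)
    (hC : IsTotallyReflexive R C) : IsTotallyReflexive R B := by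
  obtain ⟨f, g, hf, hg, hfg⟩ := h
  have hext := ext_one_extend hf hg hfg (ModuleCat.of R R) (hC.2 1 le_rfl).1
  have hfs : Function.Surjective f.dualMap := hext
  obtain ⟨hgi, hd⟩ := dual_exact (f := f) hg hfg
  refine ⟨⟨?_, ?_⟩, ?_⟩
  · rw [injective_iff_map_eq_zero]
    intro b hb
    have hgb : g b = 0 := by
      apply hC.1.1
      ext χ
      simpa using LinearMap.congr_fun hb (g.dualMap χ)
    have : b ∈ LinearMap.range f := by rw [hfg]; exact hgb
    obtain ⟨a, rfl⟩ := this
    have : a = 0 := by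
      apply hA.1.1
      ext α
      obtain ⟨β, rfl⟩ := hfs α
      simpa using LinearMap.congr_fun hb β
    simp [this]
  · intro ξ
    obtain ⟨c, hc⟩ := hC.1.2 (ξ ∘ₗ g.dualMap)
    obtain ⟨b, rfl⟩ := hg c
    obtain ⟨-, hd2⟩ := dual_exact (A := ModuleCat.of R (Module.Dual R C))
      (B := ModuleCat.of R (Module.Dual R B)) (C := ModuleCat.of R (Module.Dual R A))
      (f := g.dualMap) (g := f.dualMap) hfs hd
    have hk : ξ - Module.Dual.eval R B b ∈ LinearMap.ker g.dualMap.dualMap := by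
      rw [LinearMap.mem_ker]
      ext χ
      have := LinearMap.congr_fun hc χ
      have h2 : χ (g b) = ξ (χ ∘ₗ g) := this
      simp [LinearMap.dualMap_apply', h2]
    have hk' : ξ - Module.Dual.eval R B b ∈ LinearMap.range f.dualMap.dualMap := hd2 ▸ hk
    obtain ⟨η, hη⟩ := hk'
    obtain ⟨a, rfl⟩ := hA.1.2 η
    refine ⟨b + f a, ?_⟩
    have h3 : f.dualMap.dualMap (Module.Dual.eval R A a) = Module.Dual.eval R B (f a) := rfl
    rw [map_add, ← h3, hη]
    abel
  · intro i hi
    obtain ⟨i, rfl⟩ := Nat.exists_eq_add_of_le' hi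
    refine ⟨ext_mid hf hg hfg _ i (hA.2 _ (by omega)).1 (hC.2 _ (by omega)).1, ?_⟩
    exact ext_mid (A := ModuleCat.of R (Module.Dual R C)) (B := ModuleCat.of R (Module.Dual R B))
        (C := ModuleCat.of R (Module.Dual R A)) (f := g.dualMap) (g := f.dualMap)
        hgi hfs hd _ i (hC.2 _ (by omega)).2 (hA.2 _ (by omega)).2

lemma ext_free (F N : ModuleCat.{u} R) (hF : Module.Free R F) (i : ℕ) :
    ExtVanishes R F N (i + 1) := by
  have : Projective F := ModuleCat.projective_of_free (Module.Free.chooseBasis R F)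
  have := isZero_Ext_succ_of_projective (R := R) F N i
  rwa [ModuleCat.isZero_iff_subsingleton] at this

lemma tr_free (F : ModuleCat.{u} R) (hF : IsFinFree R F) : IsTotallyReflexive R F := by
  obtain ⟨h1, h2⟩ := hF
  refine ⟨Module.IsReflexive.bijective_dual_eval', ?_⟩
  intro i hi
  obtain ⟨i, rfl⟩ := Nat.exists_eq_add_of_le' hi
  exact ⟨ext_free _ _ h2 _, ext_free _ _ (inferInstanceAs (Module.Free R (Module.Dual R F))) _⟩

lemma SES.congr {A B C A' B' C' : ModuleCat.{u} R} (h : SES R A B C) (a : A' ≃ₗ[R] A)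
    (b : B ≃ₗ[R] B') (c : C ≃ₗ[R] C') : SES R A' B' C' := by
  obtain ⟨f, g, hf, hg, hfg⟩ := h
  refine ⟨b.toLinearMap ∘ₗ f ∘ₗ a.toLinearMap, c.toLinearMap ∘ₗ g ∘ₗ b.symm.toLinearMap,
    ?_, ?_, ?_⟩
  · simpa using hf
  · simpa using hg
  · ext x
    have := SetLike.ext_iff.1 hfg (b.symm x)
    simp only [LinearMap.mem_range, LinearMap.mem_ker, LinearMap.comp_apply,
      LinearEquiv.coe_coe, EmbeddingLike.map_eq_zero_iff] at this ⊢
    rw [← this]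
    constructor
    · rintro ⟨y, rfl⟩
      exact ⟨a y, by simp⟩
    · rintro ⟨y, hy⟩
      exact ⟨a.symm y, by simp [hy]⟩

lemma ses_kernel {B C : ModuleCat.{u} R} (g : B →ₗ[R] C) (hg : Function.Surjective g) :
    SES R (ModuleCat.of R (LinearMap.ker g)) B C :=
  ⟨(LinearMap.ker g).subtype, g, Subtype.val_injective, hg, by simp⟩

lemma ses_prod (A C : ModuleCat.{u} R) : SES R A (ModuleCat.of R (A × C)) C :=
  ⟨LinearMap.inl R A C, LinearMap.snd R A C, LinearMap.inl_injective, LinearMap.snd_surjective,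
    LinearMap.range_inl R A C⟩

lemma ses_zero (A B : ModuleCat.{u} R) (e : A ≃ₗ[R] B) :
    SES R A B (ModuleCat.of R PUnit.{u+1}) :=
  ⟨e.toLinearMap, 0, e.injective, fun _ => ⟨0, rfl⟩, by simp⟩

lemma tr_iso {A B : ModuleCat.{u} R} (e : A ≃ₗ[R] B) (h : IsTotallyReflexive R A) :
    IsTotallyReflexive R B :=
  tr_mid (ses_zero A B e) h (tr_free _ ⟨inferInstance, inferInstance⟩)

lemma resolved_ker (m : ℕ) {N L G : ModuleCat.{u} R} (hN : ResolvedBy R (IsTotallyReflexive R) m N)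
    (h : SES R L N G) (hG : IsTotallyReflexive R G) :
    ResolvedBy R (IsTotallyReflexive R) m L := by
  cases m with
  | zero =>
    obtain ⟨G0, hG0, ⟨e⟩⟩ := hN
    exact ⟨L, tr_ker h (tr_iso e hG0) hG, ⟨LinearEquiv.refl R L⟩⟩
  | succ m =>
    obtain ⟨G1, S, hG1, ⟨i, p, hi, hp, hip⟩, hS⟩ := hN
    obtain ⟨f, g, hf, hg, hfg⟩ := h
    have hgp : Function.Surjective (g ∘ₗ p) := hg.comp hp
    let eL := LinearEquiv.ofInjective f hf
    let q : LinearMap.ker (g ∘ₗ p) →ₗ[R] LinearMap.range f :=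
      (p.comp (LinearMap.ker (g ∘ₗ p)).subtype).codRestrict _ (fun x => by
        rw [hfg]; exact x.2)
    refine ⟨ModuleCat.of R (LinearMap.ker (g ∘ₗ p)), S, tr_ker (ses_kernel _ hgp) hG1 hG, ?_, hS⟩
    have hipx : ∀ x, p (i x) = 0 := fun x => by
      rw [← LinearMap.mem_ker, ← hip]; exact LinearMap.mem_range_self _ _
    refine ⟨i.codRestrict _ (fun x => by simp [hipx]), eL.symm.toLinearMap ∘ₗ q, ?_, ?_, ?_⟩
    · intro x y hxy
      exact hi (congrArg Subtype.val hxy)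
    · refine eL.symm.surjective.comp ?_
      rintro ⟨y, hy⟩
      obtain ⟨x, rfl⟩ := hp y
      have : p x ∈ LinearMap.ker g := hfg ▸ hy
      exact ⟨⟨x, this⟩, rfl⟩
    · ext ⟨x, hx⟩
      have h1 := SetLike.ext_iff.1 hip x
      have h2 : q ⟨x, hx⟩ = 0 ↔ p x = 0 := by
        rw [Subtype.ext_iff]; rfl
      simp only [LinearMap.mem_range, LinearMap.mem_ker, LinearMap.comp_apply,
        LinearEquiv.coe_coe, EmbeddingLike.map_eq_zero_iff, h2] at h1 ⊢
      rw [← h1]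
      simp [Subtype.ext_iff]

lemma resolved_prod (m : ℕ) {N F : ModuleCat.{u} R}
    (hN : ResolvedBy R (IsTotallyReflexive R) m N) (hF : IsFinFree R F) :
    ResolvedBy R (IsTotallyReflexive R) m (ModuleCat.of R (N × F)) := by
  cases m with
  | zero =>
    obtain ⟨G0, hG0, ⟨e⟩⟩ := hN
    exact ⟨_, tr_mid (ses_prod N F) (tr_iso e hG0) (tr_free F hF), ⟨LinearEquiv.refl R _⟩⟩
  | succ m =>
    obtain ⟨G1, S, hG1, ⟨i, p, hi, hp, hip⟩, hS⟩ := hN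
    refine ⟨ModuleCat.of R (G1 × F), S, tr_mid (ses_prod G1 F) hG1 (tr_free F hF), ?_, hS⟩
    refine ⟨LinearMap.inl R G1 F ∘ₗ i, LinearMap.prodMap p LinearMap.id, ?_, ?_, ?_⟩
    · exact LinearMap.inl_injective.comp hi
    · exact Function.Surjective.prodMap hp Function.surjective_id
    · ext ⟨x, y⟩
      have h1 := SetLike.ext_iff.1 hip x
      simp only [LinearMap.mem_range, LinearMap.mem_ker] at h1
      simp [← h1, Prod.ext_iff, eq_comm]

lemma exists_lift_inj {S G L : ModuleCat.{u} R} (f : S →ₗ[R] G) (hf : Function.Injective f)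
    (h : L →ₗ[R] G) (hh : ∀ x, h x ∈ LinearMap.range f) : ∃ σ : L →ₗ[R] S, ∀ x, f (σ x) = h x := by
  let e := LinearEquiv.ofInjective f hf
  refine ⟨e.symm.toLinearMap ∘ₗ h.codRestrict _ hh, fun x => ?_⟩
  have : (e (e.symm (h.codRestrict _ hh x)) : G) = h x := by simp
  exact this

lemma resolved_syz (m : ℕ) {K L F : ModuleCat.{u} R}
    (hK : ResolvedBy R (IsTotallyReflexive R) m K) (h : SES R L F K) (hF : IsFinFree R F) :
    FiniteGdim R L := by
  cases m with
  | zero =>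
    obtain ⟨G0, hG0, ⟨e⟩⟩ := hK
    exact ⟨0, L, tr_ker h (tr_free F hF) (tr_iso e hG0), ⟨LinearEquiv.refl R L⟩⟩
  | succ m =>
    obtain ⟨G, S, hG, ⟨f, q, hf, hq, hfq⟩, hS⟩ := hK
    obtain ⟨ι, p, hι, hp, hιp⟩ := h
    have := hF.2
    obtain ⟨h, hh⟩ := Module.projective_lifting_property q p hq
    have hh' : ∀ x, q (h x) = p x := fun x => LinearMap.congr_fun hh x
    have hqf : ∀ x, q (f x) = 0 := fun x => by
      rw [← LinearMap.mem_ker, ← hfq]; exact LinearMap.mem_range_self _ _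
    have hpι : ∀ x, p (ι x) = 0 := fun x => by
      rw [← LinearMap.mem_ker, ← hιp]; exact LinearMap.mem_range_self _ _
    obtain ⟨σ, hσ⟩ := exists_lift_inj f hf (-(h ∘ₗ ι)) (fun x => by
      rw [hfq, LinearMap.mem_ker]; simp [hh', hpι])
    refine ⟨m, resolved_ker m (resolved_prod m hS hF) (G := G) ?_ hG⟩
    refine ⟨LinearMap.prod σ ι, LinearMap.coprod f h, ?_, ?_, ?_⟩
    · intro x y hxy
      exact hι (congrArg Prod.snd hxy)
    · intro y
      obtain ⟨x, hx⟩ := hp (q y)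
      have : y - h x ∈ LinearMap.range f := by
        rw [hfq, LinearMap.mem_ker]; simp [hh', hx]
      obtain ⟨s, hs⟩ := this
      exact ⟨(s, x), by simp [hs]⟩
    · ext ⟨s, x⟩
      rw [LinearMap.mem_ker]
      constructor
      · rintro ⟨l, hl⟩
        rw [← hl]
        simp [hσ]
      · intro hx
        have hx' : f s + h x = 0 := hx
        have : x ∈ LinearMap.range ι := by
          have := congrArg q hx'
          rw [map_add, hqf, zero_add, hh', map_zero] at this
          rw [hιp]; exact this
        obtain ⟨l, rfl⟩ := this
        refine ⟨l, ?_⟩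
        have : σ l = s := hf (by rw [hσ]; simpa using (eq_neg_of_add_eq_zero_left hx').symm)
        exact Prod.ext this rfl

end TRPart

section SyzPart

variable {R}

lemma SES.finite_left [IsNoetherianRing R] {A B C : ModuleCat.{u} R} (h : SES R A B C)
    (hB : Module.Finite R B) : Module.Finite R A := by
  obtain ⟨f, g, hf, -, -⟩ := h
  exact Module.Finite.of_injective f hf

lemma exists_cover (M : ModuleCat.{u} R) (hM : Module.Finite R M) :
    ∃ (H : ModuleCat.{u} R) (p : H →ₗ[R] M), IsFinFree R H ∧ Function.Surjective p := by
  obtain ⟨n, p, hp⟩ := Module.Finite.exists_fin' R M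
  exact ⟨ModuleCat.of R (Fin n → R), p,
    ⟨inferInstanceAs (Module.Finite R (Fin n → R)), inferInstanceAs (Module.Free R (Fin n → R))⟩,
    hp⟩

lemma free_ker [IsNoetherianRing R] [IsLocalRing R] {Q G : Type u} [AddCommGroup Q] [Module R Q]
    [AddCommGroup G] [Module R G] [Module.Finite R Q] [Module.Free R Q] [Module.Free R G]
    (q : Q →ₗ[R] G) (hq : Function.Surjective q) :
    IsFinFree R (ModuleCat.of R (LinearMap.ker q)) := by
  obtain ⟨s, hs⟩ := Module.projective_lifting_property q LinearMap.id hq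
  have hs' : ∀ x, q (s x) = x := fun x => LinearMap.congr_fun hs x
  have hfin : Module.Finite R (LinearMap.ker q) := inferInstance
  have hproj : Module.Projective R (LinearMap.ker q) := by
    refine Module.Projective.of_split (LinearMap.ker q).subtype
      ((LinearMap.id - s ∘ₗ q).codRestrict (LinearMap.ker q) (fun x => by simp [hs'])) ?_
    ext ⟨x, hx⟩
    rw [LinearMap.mem_ker] at hx
    simp [hx]
  have : Module.Free R (LinearMap.ker q) := Module.free_of_flat_of_isLocalRing
  exact ⟨hfin, this⟩

lemma syz_shift [IsNoetherianRing R] [IsLocalRing R] (n : ℕ) :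
    ∀ {S K T F : ModuleCat.{u} R}, IsSyzygy R n S K → SES R T F K → IsFinFree R F →
    ∃ S' H : ModuleCat.{u} R, IsSyzygy R n S' T ∧ IsFinFree R H ∧ SES R S' H S := by
  induction n with
  | zero =>
    rintro S K T F ⟨e⟩ h hF
    exact ⟨T, F, ⟨LinearEquiv.refl R T⟩, hF,
      h.congr (LinearEquiv.refl R T) (LinearEquiv.refl R F) e.symm⟩
  | succ n ih =>
    rintro S K T F ⟨U, F1, hU, hF1, ⟨i, p, hi, hp, hip⟩⟩ h hF
    obtain ⟨V, G, hV, hG, hVG⟩ := ih hU h hF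
    have hVfin := hVG.finite_left hG.1
    obtain ⟨j, q, hj, hq, hjq⟩ := hVG
    obtain ⟨H0, c, hH0, hc⟩ := exists_cover V hVfin
    have hqj : ∀ x, q (j x) = 0 := fun x => by
      rw [← LinearMap.mem_ker, ← hjq]; exact LinearMap.mem_range_self _ _
    have hpi : ∀ x, p (i x) = 0 := fun x => by
      rw [← LinearMap.mem_ker, ← hip]; exact LinearMap.mem_range_self _ _
    have := hF1.1
    have := hF1.2
    have := hG.2
    have := hH0.1
    have := hH0.2
    obtain ⟨l, hl⟩ := Module.projective_lifting_property q p hq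
    have hl' : ∀ x, q (l x) = p x := fun x => LinearMap.congr_fun hl x
    let Q : (H0 × F1) →ₗ[R] G := LinearMap.coprod (j ∘ₗ c) l
    have hQ : Function.Surjective Q := by
      intro y
      obtain ⟨x, hx⟩ := hp (q y)
      have : y - l x ∈ LinearMap.range j := by
        rw [hjq, LinearMap.mem_ker]; simp [hl', hx]
      obtain ⟨v, hv⟩ := this
      obtain ⟨w, rfl⟩ := hc v
      exact ⟨(w, x), by simp [Q, hv]⟩
    have hQ0 : ∀ x : LinearMap.ker Q, j (c x.1.1) + l x.1.2 = 0 := fun x => x.2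
    obtain ⟨σ, hσ⟩ := exists_lift_inj (L := ModuleCat.of R (LinearMap.ker Q)) i hi
      (LinearMap.snd R H0 F1 ∘ₗ (LinearMap.ker Q).subtype) (fun x => by
        have := congrArg q (hQ0 x)
        rw [map_add, hqj, zero_add, hl', map_zero] at this
        rw [hip]; exact this)
    have hσ' : ∀ x : LinearMap.ker Q, i (σ x) = x.1.2 := hσ
    refine ⟨ModuleCat.of R (LinearMap.ker c), ModuleCat.of R (LinearMap.ker Q),
      ⟨V, H0, hV, hH0, ses_kernel c hc⟩, free_ker Q hQ, ?_⟩
    refine ⟨(LinearMap.inl R H0 F1 ∘ₗ (LinearMap.ker c).subtype).codRestrict _ ?_, σ, ?_, ?_, ?_⟩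
    · rintro ⟨x, hx⟩
      rw [LinearMap.mem_ker] at hx
      simp [Q, hx]
    · intro x y hxy
      apply Subtype.ext
      exact congrArg (fun z : LinearMap.ker Q => z.1.1) hxy
    · intro s
      have : - l (i s) ∈ LinearMap.range j := by
        rw [hjq, LinearMap.mem_ker]; simp [hl', hpi]
      obtain ⟨v, hv⟩ := this
      obtain ⟨w, rfl⟩ := hc v
      refine ⟨⟨(w, i s), by simp [Q, hv]⟩, hi ?_⟩
      rw [hσ']
    · ext x
      rw [LinearMap.mem_ker]
      constructor
      · rintro ⟨y, rfl⟩
        exact hi ((hσ' _).trans (map_zero i).symm)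
      · intro hx
        have h2 : x.1.2 = 0 := by rw [← hσ', hx, map_zero]
        have h1 : c x.1.1 = 0 := by
          have := hQ0 x
          rw [h2, map_zero, add_zero] at this
          exact hj (by rw [this, map_zero])
        exact ⟨⟨x.1.1, h1⟩, Subtype.ext (Prod.ext rfl h2.symm)⟩

lemma ses_pow {A B C : ModuleCat.{u} R} (h : SES R A B C) (a : ℕ) :
    SES R (MPow R A a) (MPow R B a) (MPow R C a) := by
  obtain ⟨f, g, hf, hg, hfg⟩ := h
  refine ⟨f.compLeft (Fin a), g.compLeft (Fin a), ?_, ?_, ?_⟩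
  · intro x y hxy
    funext k
    exact hf (congrFun hxy k)
  · intro y
    choose x hx using fun k => hg (y k)
    exact ⟨x, funext hx⟩
  · ext y
    change _ ↔ g.compLeft (Fin a) y = 0
    constructor
    · rintro ⟨x, rfl⟩
      funext k
      have : f (x k) ∈ LinearMap.ker g := hfg ▸ LinearMap.mem_range_self f _
      exact this
    · intro hy
      have : ∀ k, ∃ x, f x = y k := fun k => by
        have : y k ∈ LinearMap.range f := by rw [hfg]; exact congrFun hy k
        exact this
      choose x hx using this
      exact ⟨x, funext hx⟩

lemma finfree_pow {F : ModuleCat.{u} R} (h : IsFinFree R F) (a : ℕ) :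
    IsFinFree R (MPow R F a) := by
  have := h.1
  have := h.2
  exact ⟨inferInstanceAs (Module.Finite R (Fin a → F)),
    inferInstanceAs (Module.Free R (Fin a → F))⟩

/-- Horseshoe. -/
lemma horseshoe {A B C A' C' F H : ModuleCat.{u} R} (h : SES R A B C) (hA : SES R A' F A)
    (hC : SES R C' H C) (hF : IsFinFree R F) (hH : IsFinFree R H) :
    ∃ B' E : ModuleCat.{u} R, SES R A' B' C' ∧ IsFinFree R E ∧ SES R B' E B := by
  obtain ⟨f, g, hf, hg, hfg⟩ := h
  obtain ⟨s, p, hs, hp, hsp⟩ := hA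
  obtain ⟨t, q, ht, hq, htq⟩ := hC
  have := hF.1
  have := hF.2
  have := hH.1
  have := hH.2
  obtain ⟨μ, hμ⟩ := Module.projective_lifting_property g q hg
  have hμ' : ∀ x, g (μ x) = q x := fun x => LinearMap.congr_fun hμ x
  have hgf : ∀ x, g (f x) = 0 := fun x => by
    rw [← LinearMap.mem_ker, ← hfg]; exact LinearMap.mem_range_self _ _
  have hps : ∀ x, p (s x) = 0 := fun x => by
    rw [← LinearMap.mem_ker, ← hsp]; exact LinearMap.mem_range_self _ _
  have hqt : ∀ x, q (t x) = 0 := fun x => by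
    rw [← LinearMap.mem_ker, ← htq]; exact LinearMap.mem_range_self _ _
  let Q : (F × H) →ₗ[R] B := LinearMap.coprod (f ∘ₗ p) μ
  have hQ : Function.Surjective Q := by
    intro y
    obtain ⟨x, hx⟩ := hq (g y)
    have : y - μ x ∈ LinearMap.range f := by
      rw [hfg, LinearMap.mem_ker]; simp [hμ', hx]
    obtain ⟨v, hv⟩ := this
    obtain ⟨w, rfl⟩ := hp v
    exact ⟨(w, x), by simp [Q, hv]⟩
  have hQ0 : ∀ x : LinearMap.ker Q, f (p x.1.1) + μ x.1.2 = 0 := fun x => x.2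
  obtain ⟨σ, hσ⟩ := exists_lift_inj (L := ModuleCat.of R (LinearMap.ker Q)) t ht
    (LinearMap.snd R F H ∘ₗ (LinearMap.ker Q).subtype) (fun x => by
      have := congrArg g (hQ0 x)
      rw [map_add, hgf, zero_add, hμ', map_zero] at this
      rw [htq]; exact this)
  have hσ' : ∀ x : LinearMap.ker Q, t (σ x) = x.1.2 := hσ
  refine ⟨ModuleCat.of R (LinearMap.ker Q), ModuleCat.of R (F × H), ?_,
    ⟨inferInstanceAs (Module.Finite R (F × H)), inferInstanceAs (Module.Free R (F × H))⟩,
    ses_kernel (B := ModuleCat.of R (F × H)) Q hQ⟩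
  refine ⟨(LinearMap.inl R F H ∘ₗ s).codRestrict _ ?_, σ, ?_, ?_, ?_⟩
  · intro x
    simp [Q, hps]
  · intro x y hxy
    exact hs (congrArg (fun z : LinearMap.ker Q => z.1.1) hxy)
  · intro c
    have : - μ (t c) ∈ LinearMap.range f := by
      rw [hfg, LinearMap.mem_ker]; simp [hμ', hqt]
    obtain ⟨v, hv⟩ := this
    obtain ⟨w, rfl⟩ := hp v
    refine ⟨⟨(w, t c), by simp [Q, hv]⟩, ht ?_⟩
    rw [hσ']
  · ext x
    rw [LinearMap.mem_ker]
    constructor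
    · rintro ⟨y, rfl⟩
      exact ht ((hσ' _).trans (map_zero t).symm)
    · intro hx
      have h2 : x.1.2 = 0 := by rw [← hσ', hx, map_zero]
      have h1 : p x.1.1 = 0 := by
        have := hQ0 x
        rw [h2, map_zero, add_zero] at this
        exact hf (by rw [this, map_zero])
      have : x.1.1 ∈ LinearMap.range s := by rw [hsp]; exact h1
      obtain ⟨y, hy⟩ := this
      exact ⟨y, Subtype.ext (Prod.ext hy h2.symm)⟩

lemma red_syz [IsNoetherianRing R] [IsLocalRing R] (r : ℕ) :
    ∀ (K : Fin (r + 1) → ModuleCat.{u} R), IsReducingSeq R K → FiniteGdim R (K (Fin.last r)) →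
    ∀ T F : ModuleCat.{u} R, SES R T F (K 0) → IsFinFree R F → FiniteRedGdim R T := by
  induction r with
  | zero =>
    intro K hK hG T F h hF
    obtain ⟨m, hm⟩ := hG
    refine ⟨0, fun _ => T, rfl, ⟨fun _ => h.finite_left hF.1, fun _ => 1, fun _ => 1, fun _ => 1,
      fun _ => one_pos, fun _ => one_pos, fun _ => one_pos, fun i => i.elim0⟩, ?_⟩
    exact resolved_syz m hm h hF
  | succ r ih =>
    intro K hK hG T F h hF
    obtain ⟨hfin, a, b, n, ha, hb, hn, hS⟩ := hK
    obtain ⟨S, hS1, hS2⟩ := hS 0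
    obtain ⟨S', H, hS', hH, hSH⟩ := syz_shift (n 0) hS1 (ses_pow h (b 0)) (finfree_pow hF (b 0))
    obtain ⟨L, E, hL, hE, hLE⟩ := horseshoe hS2 (ses_pow h (a 0)) hSH (finfree_pow hF (a 0)) hH
    obtain ⟨r', K', hK'0, ⟨hfin', a', b', n', ha', hb', hn', hS''⟩, hG'⟩ :=
      ih (fun i => K i.succ)
        ⟨fun i => hfin _, fun i => a i.succ, fun i => b i.succ, fun i => n i.succ,
          fun i => ha _, fun i => hb _, fun i => hn _, fun i => hS i.succ⟩ hG L E hLE hE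
    refine ⟨r' + 1, Fin.cons T K', rfl, ⟨?_, Fin.cons (a 0) a', Fin.cons (b 0) b',
      Fin.cons (n 0) n', ?_, ?_, ?_, ?_⟩, hG'⟩
    · intro i
      refine Fin.cases ?_ (fun i => ?_) i
      · exact h.finite_left hF.1
      · exact hfin' i
    · exact fun i => Fin.cases (ha 0) ha' i
    · exact fun i => Fin.cases (hb 0) hb' i
    · exact fun i => Fin.cases (hn 0) hn' i
    · intro i
      refine Fin.cases ?_ (fun i => ?_) i
      · refine ⟨S', hS', ?_⟩
        have : (Fin.cons T K' : Fin (r' + 2) → ModuleCat.{u} R) (Fin.succ 0) = L := hK'0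
        rw [this]
        exact hL
      · exact hS'' i

end SyzPart

theorem finiteRedGdim_syzygy
    (R : Type u) [CommRing R] [IsNoetherianRing R] [IsLocalRing R]
    (M F : ModuleCat.{u} R) (hM : Module.Finite R M) (hF : IsFinFree R F)
    (π : F →ₗ[R] M) (hπ : Function.Surjective π)
    (hred : FiniteRedGdim R M) :
    FiniteRedGdim R (ModuleCat.of R (LinearMap.ker π)) := by
  obtain ⟨r, K, rfl, hK, hG⟩ := hred
  exact red_syz r K hK hG _ F (ses_kernel π hπ) hF
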